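/- arXiv:1711.09039 — 2 statements merged into one kernel-verified Lean document; each statement's English description precedes it below -/
import Mathlib

section
/- Let U and V be independent random variables, each distributed as the sum of squares of 2k independent standard Gaussian random variables. Then for every ε ∈ (0,2) such that γ := √(ln(2/ε)/(2k)) ≤ 0.05, one has: Pr[ V ≥ (1 + 4γ) U ] ≤ ε and Pr[ V ≤ (1 − 4γ) U ] ≤ ε. -/
open MeasureTheory ProbabilityTheory

/-- The law of a `χ²` statistic with `m` degrees of freedom: the distribution
of the sum of squares of `m` independent standard Gaussian random variables. -/
noncomputable def chiSqLaw (m : ℕ) : Measure ℝ :=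
  Measure.map (fun z : Fin m → ℝ => ∑ i, (z i) ^ 2)
    (Measure.pi fun _ : Fin m => gaussianReal 0 1)

/-- The moment generating function of the square of a standard Gaussian. -/
lemma integral_exp_mul_sq_gaussianReal {t : ℝ} (ht : t < 1 / 2) :
    ∫ x, Real.exp (t * x ^ 2) ∂gaussianReal 0 1 = (√(1 - 2 * t))⁻¹ := by
  rw [integral_gaussianReal_eq_integral_smul one_ne_zero]
  have h : ∀ x : ℝ, gaussianPDFReal 0 1 x • Real.exp (t * x ^ 2) =
      (√(2 * Real.pi))⁻¹ * Real.exp (-(1 / 2 - t) * x ^ 2) := fun x ↦ by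
    rw [gaussianPDFReal, smul_eq_mul, mul_assoc, ← Real.exp_add]
    simp only [NNReal.coe_one, mul_one, sub_zero]
    ring_nf
  simp_rw [h]
  rw [integral_const_mul, integral_gaussian, ← Real.sqrt_inv, ← Real.sqrt_inv,
    ← Real.sqrt_mul (by positivity)]
  have h2 : 1 - 2 * t ≠ 0 := by linarith
  have h3 : 1 / 2 - t ≠ 0 := by linarith
  have := Real.pi_ne_zero
  congr 1
  field_simp

/-- The moment generating function of the `χ²` law with `2 * k` degrees of freedom. -/
lemma integral_exp_mul_chiSqLaw (k : ℕ) {t : ℝ} (ht : t < 1 / 2) :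
    ∫ x, Real.exp (t * x) ∂chiSqLaw (2 * k) = ((1 - 2 * t) ^ k)⁻¹ := by
  have hm : Measurable fun z : Fin (2 * k) → ℝ ↦ ∑ i, z i ^ 2 := by fun_prop
  rw [chiSqLaw, integral_map hm.aemeasurable (by fun_prop)]
  simp_rw [Finset.mul_sum, Real.exp_sum]
  rw [integral_fintype_prod_eq_pow (fun x : ℝ ↦ Real.exp (t * x ^ 2)),
    integral_exp_mul_sq_gaussianReal ht, Fintype.card_fin, pow_mul, inv_pow,
    Real.sq_sqrt (by linarith), inv_pow]

section

variable {Ω : Type*} [MeasurableSpace Ω] {μ : Measure Ω} {k : ℕ} {U V : Ω → ℝ}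

lemma integral_exp_mul_of_map_eq_chiSqLaw (hU : Measurable U)
    (hUd : Measure.map U μ = chiSqLaw (2 * k)) {t : ℝ} (ht : t < 1 / 2) :
    ∫ ω, Real.exp (t * U ω) ∂μ = ((1 - 2 * t) ^ k)⁻¹ := by
  rw [← integral_exp_mul_chiSqLaw k ht, ← hUd, integral_map (by fun_prop) (by fun_prop)]

lemma integrable_exp_mul_of_map_eq_chiSqLaw (hU : Measurable U)
    (hUd : Measure.map U μ = chiSqLaw (2 * k)) {t : ℝ} (ht : t < 1 / 2) :
    Integrable (fun ω ↦ Real.exp (t * U ω)) μ := by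
  refine Integrable.of_integral_ne_zero ?_
  rw [integral_exp_mul_of_map_eq_chiSqLaw hU hUd ht]
  have : 0 < 1 - 2 * t := by linarith
  positivity

/-- Chernoff bound for a linear combination of independent `χ²` statistics. -/
lemma measureReal_linear_comb_nonneg_le [IsProbabilityMeasure μ] (hU : Measurable U)
    (hV : Measurable V) (hindep : IndepFun U V μ)
    (hUd : Measure.map U μ = chiSqLaw (2 * k)) (hVd : Measure.map V μ = chiSqLaw (2 * k))
    {p q : ℝ} (hp : p < 1 / 2) (hq : q < 1 / 2) :
    μ.real {ω | 0 ≤ p * U ω + q * V ω} ≤ (((1 - 2 * p) * (1 - 2 * q)) ^ k)⁻¹ := by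
  have hind := hindep.exp_mul p q
  have hpU := integrable_exp_mul_of_map_eq_chiSqLaw hU hUd hp
  have hqV := integrable_exp_mul_of_map_eq_chiSqLaw hV hVd hq
  have h := mul_meas_ge_le_integral_of_nonneg
    (ae_of_all μ fun ω ↦ by simp only [Pi.zero_apply, Pi.mul_apply]; positivity)
    (hind.integrable_mul hpU hqV) 1
  rw [hind.integral_mul_eq_mul_integral hpU.1 hqV.1,
    integral_exp_mul_of_map_eq_chiSqLaw hU hUd hp,
    integral_exp_mul_of_map_eq_chiSqLaw hV hVd hq, ← mul_inv, ← mul_pow, one_mul] at h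
  simpa only [Pi.mul_apply, ← Real.exp_add, Real.one_le_exp_iff] using h

/-- Tail bound for the ratio of two independent `χ²` statistics: the event says that `V / U` lies
on the far side of `r`, as seen from `1`. -/
lemma measureReal_ratio_tail_le [IsProbabilityMeasure μ] (hU : Measurable U)
    (hV : Measurable V) (hindep : IndepFun U V μ)
    (hUd : Measure.map U μ = chiSqLaw (2 * k)) (hVd : Measure.map V μ = chiSqLaw (2 * k))
    {r : ℝ} (hr : 0 < r) :
    μ.real {ω | 0 ≤ (r - 1) * (V ω - r * U ω)} ≤ ((1 + (r - 1) ^ 2 / (4 * r)) ^ k)⁻¹ := by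
  have hq : (r - 1) / (4 * r) < 1 / 2 := by
    rw [div_lt_div_iff₀ (by positivity) (by norm_num)]
    linarith
  have h := measureReal_linear_comb_nonneg_le hU hV hindep hUd hVd
    (p := (1 - r) / 4) (by linarith) hq
  have hset : {ω | 0 ≤ (1 - r) / 4 * U ω + (r - 1) / (4 * r) * V ω} =
      {ω | 0 ≤ (r - 1) * (V ω - r * U ω)} := by
    ext ω
    have : (1 - r) / 4 * U ω + (r - 1) / (4 * r) * V ω =
        (r - 1) * (V ω - r * U ω) / (4 * r) := by
      field_simp
      ring
    simp only [Set.mem_ofPred_eq, this]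
    rw [le_div_iff₀ (by positivity), zero_mul]
  have hval : (1 - 2 * ((1 - r) / 4)) * (1 - 2 * ((r - 1) / (4 * r))) =
      1 + (r - 1) ^ 2 / (4 * r) := by
    field_simp
    ring
  rwa [hset, hval] at h

end

lemma exp_two_mul_le {x y : ℝ} (hx : 0 ≤ x) (hx' : x ≤ 1 / 5) (hy : 10 / 3 * x ≤ y) :
    Real.exp (2 * x) ≤ 1 + y := by
  have h : 1 - 2 * x ≤ Real.exp (-(2 * x)) := by
    linarith [Real.add_one_le_exp (-(2 * x))]
  have h1 : Real.exp (2 * x) * (1 - 2 * x) ≤ 1 := by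
    calc _ ≤ Real.exp (2 * x) * Real.exp (-(2 * x)) := by gcongr
      _ = 1 := by rw [← Real.exp_add]; simp
  have h2 : Real.exp (2 * x) ≤ 1 / (1 - 2 * x) := by
    rwa [le_div_iff₀ (by linarith)]
  refine h2.trans ?_
  rw [div_le_iff₀ (by linarith)]
  nlinarith

/-- First two inequalities of Lemma 4 (X1givesX2): for independent `χ²(2k)`
statistics `U` and `V` and `γ = √(ln(2/ε)/(2k)) ≤ 0.05`, the ratio `V/U` is
pinched between `1 - 4γ` and `1 + 4γ` except with probability `ε` each. -/
theorem chiSq_halves_ratio_bounds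
    {Ω : Type*} [MeasurableSpace Ω] (μ : Measure Ω) [IsProbabilityMeasure μ]
    (k : ℕ) (hk : 0 < k) (U V : Ω → ℝ)
    (hU : Measurable U) (hV : Measurable V)
    (hindep : IndepFun U V μ)
    (hUd : Measure.map U μ = chiSqLaw (2 * k)) (hVd : Measure.map V μ = chiSqLaw (2 * k))
    (ε : ℝ) (hε0 : 0 < ε) (hε2 : ε < 2)
    (γ : ℝ) (hγdef : γ = Real.sqrt (Real.log (2 / ε) / (2 * k)))
    (hγ : γ ≤ 0.05) :
    μ {ω | V ω ≥ (1 + 4 * γ) * U ω} ≤ ENNReal.ofReal ε ∧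
    μ {ω | V ω ≤ (1 - 4 * γ) * U ω} ≤ ENNReal.ofReal ε := by
  have hk' : (0 : ℝ) < k := by exact_mod_cast hk
  have hlog : 0 < Real.log (2 / ε) := Real.log_pos (by rwa [one_lt_div hε0])
  have hγ0 : 0 ≤ γ := hγdef ▸ Real.sqrt_nonneg _
  have hγsq : 2 * γ ^ 2 * k = Real.log (2 / ε) := by
    rw [hγdef, Real.sq_sqrt (by positivity)]
    field_simp
  norm_num at hγ
  have key : ∀ r : ℝ, 0 < r → r ≤ 6 / 5 → (r - 1) ^ 2 = 16 * γ ^ 2 →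
      μ {ω | 0 ≤ (r - 1) * (V ω - r * U ω)} ≤ ENNReal.ofReal ε := by
    intro r hr hr' hrγ
    rw [← ofReal_measureReal]
    refine ENNReal.ofReal_le_ofReal
      ((measureReal_ratio_tail_le hU hV hindep hUd hVd hr).trans ?_)
    have hexp : Real.exp (2 * γ ^ 2) ≤ 1 + (r - 1) ^ 2 / (4 * r) := by
      refine exp_two_mul_le (by positivity) (by nlinarith) ?_
      rw [hrγ, le_div_iff₀ (by positivity)]
      nlinarith [sq_nonneg γ]
    calc ((1 + (r - 1) ^ 2 / (4 * r)) ^ k)⁻¹ ≤ (Real.exp (2 * γ ^ 2) ^ k)⁻¹ := by gcongr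
      _ = ε / 2 := by
        rw [← Real.exp_nat_mul, mul_comm, hγsq, Real.exp_log (by positivity), inv_div]
      _ ≤ ε := by linarith
  constructor
  · refine (measure_mono fun ω hω ↦ ?_).trans
      (key (1 + 4 * γ) (by linarith) (by linarith) (by ring))
    have hr : 0 ≤ 1 + 4 * γ - 1 := by linarith
    exact mul_nonneg hr (sub_nonneg.2 hω)
  · refine (measure_mono fun ω hω ↦ ?_).trans
      (key (1 - 4 * γ) (by linarith) (by linarith) (by ring))
    have hr : 1 - 4 * γ - 1 ≤ 0 := by linarith
    exact mul_nonneg_of_nonpos_of_nonpos hr (sub_nonpos.2 hω)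
end

section
/- Let U and V be independent random variables, each distributed as the sum of squares of 2k independent standard Gaussian random variables. Then for all reals 0 < a ≤ y such that (y − a)/(4a) ≤ 0.05: Pr[ (U ≤ a) ∧ (V ≥ y) ] ≤ 2 exp( −2k ((y − a)/(4a))² ). -/
open MeasureTheory ProbabilityTheory

theorem exp_sq_mul_gaussianPDFReal (s x : ℝ) :
    gaussianPDFReal 0 1 x * Real.exp (s * x ^ 2)
      = (Real.sqrt (2 * Real.pi))⁻¹ * Real.exp (-(1 / 2 - s) * x ^ 2) := by
  simp only [gaussianPDFReal, NNReal.coe_one, mul_one, sub_zero, mul_assoc, ← Real.exp_add]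
  ring_nf

theorem integrable_exp_sq_gaussianReal {s : ℝ} (hs : s < 1 / 2) :
    Integrable (fun x : ℝ => Real.exp (s * x ^ 2)) (gaussianReal 0 1) := by
  rw [gaussianReal_of_var_ne_zero _ one_ne_zero,
    integrable_withDensity_iff_integrable_smul' (measurable_gaussianPDF 0 1)
      (by simp [gaussianPDF])]
  simp only [toReal_gaussianPDF, smul_eq_mul, exp_sq_mul_gaussianPDFReal]
  exact (integrable_exp_neg_mul_sq (by linarith)).const_mul _

theorem integral_exp_sq_gaussianReal {s : ℝ} (hs : s < 1 / 2) :
    ∫ x, Real.exp (s * x ^ 2) ∂(gaussianReal 0 1) = (Real.sqrt (1 - 2 * s))⁻¹ := by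
  simp only [integral_gaussianReal_eq_integral_smul one_ne_zero, smul_eq_mul,
    exp_sq_mul_gaussianPDFReal]
  rw [integral_const_mul, integral_gaussian, ← Real.sqrt_inv, ← Real.sqrt_inv,
    ← Real.sqrt_mul (by positivity)]
  congr 1
  have : 1 / 2 - s ≠ 0 := by linarith
  have : 1 - 2 * s ≠ 0 := by linarith
  field_simp

theorem measurable_sum_sq (m : ℕ) : Measurable fun z : Fin m → ℝ => ∑ i, (z i) ^ 2 := by
  fun_prop

theorem integrable_exp_chiSqLaw (m : ℕ) {s : ℝ} (hs : s < 1 / 2) :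
    Integrable (fun x : ℝ => Real.exp (s * x)) (chiSqLaw m) := by
  rw [chiSqLaw, integrable_map_measure (by fun_prop) (measurable_sum_sq m).aemeasurable]
  simp only [Function.comp_def, Finset.mul_sum, Real.exp_sum]
  exact Integrable.fintype_prod fun _ => integrable_exp_sq_gaussianReal hs

theorem mgf_chiSqLaw (k : ℕ) {s : ℝ} (hs : s < 1 / 2) :
    mgf id (chiSqLaw (2 * k)) s = ((1 - 2 * s) ^ k)⁻¹ := by
  rw [mgf, chiSqLaw, integral_map (measurable_sum_sq _).aemeasurable (by fun_prop)]
  simp only [id_eq, Finset.mul_sum, Real.exp_sum]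
  rw [integral_fintype_prod_eq_prod (fun _ x => Real.exp (s * x ^ 2))]
  simp only [integral_exp_sq_gaussianReal hs, Finset.prod_const, Finset.card_univ,
    Fintype.card_fin, pow_mul, inv_pow]
  rw [Real.sq_sqrt (by linarith)]

theorem exp_two_mul_sq_le {d : ℝ} (hd : 0 ≤ d) (hd' : d ≤ 0.05) :
    Real.exp (2 * d ^ 2) ≤ 1 + 4 * d ^ 2 / (1 + 4 * d) := by
  have hsq : d ^ 2 ≤ 0.0025 := by nlinarith
  have h := Real.abs_exp_sub_one_sub_id_le (x := 2 * d ^ 2)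
    (by rw [abs_of_nonneg (by positivity)]; linarith)
  have hfrac : 3 * d ^ 2 ≤ 4 * d ^ 2 / (1 + 4 * d) := by
    rw [le_div_iff₀ (by linarith)]
    nlinarith [sq_nonneg d]
  nlinarith [(abs_le.mp h).2, sq_nonneg d]

/-- The bound `ε₁(a,y) = 2 exp(−2k((y−a)/(4a))²)` from the proof of Theorem 1
(main parameter estimation): for independent `χ²(2k)` statistics `U, V` and
`0 < a ≤ y` with `(y−a)/(4a) ≤ 0.05`,
`Pr[(U ≤ a) ∧ (V ≥ y)] ≤ 2 exp(−2k((y−a)/(4a))²)`. -/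
theorem chiSq_joint_deviation_bound
    {Ω : Type*} [MeasurableSpace Ω] (μ : Measure Ω) [IsProbabilityMeasure μ]
    (k : ℕ) (hk : 0 < k) (U V : Ω → ℝ)
    (hU : Measurable U) (hV : Measurable V)
    (hindep : IndepFun U V μ)
    (hUd : Measure.map U μ = chiSqLaw (2 * k)) (hVd : Measure.map V μ = chiSqLaw (2 * k))
    (a y : ℝ) (ha : 0 < a) (hay : a ≤ y) (hsmall : (y - a) / (4 * a) ≤ 0.05) :
    μ {ω | U ω ≤ a ∧ V ω ≥ y}
      ≤ ENNReal.ofReal (2 * Real.exp (-2 * k * ((y - a) / (4 * a)) ^ 2)) := by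
  set d := (y - a) / (4 * a) with hd
  have hd0 : 0 ≤ d := div_nonneg (by linarith) (by linarith)
  have hy : y = (1 + 4 * d) * a := by rw [hd]; field_simp; ring
  have hc : 0 < 1 + 4 * d := by linarith
  set s := d / (1 + 4 * d) with hs
  have hs0 : 0 ≤ s := by positivity
  have hs1 : s < 1 / 2 := by rw [hs, div_lt_iff₀ hc]; linarith
  have hVb : μ.real {ω | y ≤ V ω} ≤ Real.exp (-s * y) * ((1 - 2 * s) ^ k)⁻¹ := by
    have hi := integrable_exp_chiSqLaw (2 * k) hs1
    rw [← hVd, integrable_map_measure (by fun_prop) hV.aemeasurable] at hi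
    have h := measure_ge_le_exp_mul_mgf (μ := μ) (X := V) y hs0 hi
    rwa [← mgf_id_map hV.aemeasurable, hVd, mgf_chiSqLaw k hs1] at h
  have hUb : μ.real {ω | U ω ≤ a} ≤ Real.exp (d * a) * ((1 + 2 * d) ^ k)⁻¹ := by
    have hi := integrable_exp_chiSqLaw (2 * k) (s := -d) (by linarith)
    rw [← hUd, integrable_map_measure (by fun_prop) hU.aemeasurable] at hi
    have h := measure_le_le_exp_mul_mgf (μ := μ) (X := U) a (neg_nonpos.mpr hd0) hi
    rw [← mgf_id_map hU.aemeasurable, hUd, mgf_chiSqLaw k (by linarith)] at h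
    simpa using h
  have hsy : s * y = d * a := by rw [hs, hy]; field_simp
  have hprod : (1 - 2 * s) * (1 + 2 * d) = 1 + 4 * d ^ 2 / (1 + 4 * d) := by
    rw [hs]; field_simp; ring
  have hind : μ {ω | U ω ≤ a ∧ V ω ≥ y} = μ {ω | U ω ≤ a} * μ {ω | y ≤ V ω} :=
    hindep.measure_inter_preimage_eq_mul (Set.Iic a) (Set.Ici y) measurableSet_Iic
      measurableSet_Ici
  rw [← ofReal_measureReal, measureReal_def, hind, ENNReal.toReal_mul]
  refine ENNReal.ofReal_le_ofReal ?_
  calc μ.real {ω | U ω ≤ a} * μ.real {ω | y ≤ V ω}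
      ≤ (Real.exp (d * a) * ((1 + 2 * d) ^ k)⁻¹)
          * (Real.exp (-s * y) * ((1 - 2 * s) ^ k)⁻¹) := by gcongr
    _ = (((1 - 2 * s) * (1 + 2 * d)) ^ k)⁻¹ := by
        rw [neg_mul, hsy, Real.exp_neg, mul_pow, mul_inv]
        field_simp
    _ ≤ (Real.exp (2 * d ^ 2) ^ k)⁻¹ := by
        rw [hprod]
        gcongr
        exact exp_two_mul_sq_le hd0 hsmall
    _ = Real.exp (-2 * k * d ^ 2) := by
        rw [← Real.exp_nat_mul, ← Real.exp_neg]
        ring_nf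
    _ ≤ 2 * Real.exp (-2 * k * d ^ 2) := by linarith [Real.exp_pos (-2 * k * d ^ 2)]
end
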